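/- arXiv:1109.0342 — 2 statements merged into one kernel-verified Lean document; each statement's English description precedes it below -/
import Mathlib

section
/- Assume r + q ≠ 0. Then for every i with 1 ≤ i ≤ n one has in A: Ŝ_n · T_1T_2⋯T_{i−1} = q^{i−1} Ŝ_n + ((1 − q²)/(r + q)) · Ŝ_n · E_1 · Σ_{j=1}^{i−1} q^{j−1} T_2T_3⋯T_{i−1}T_1T_2⋯T_{j−1}, where Ŝ_n = Σ_{w∈S_n} q^{ℓ(w)} T_w and empty products of T's equal 1. -/
open Finset
open scoped Pointwise

namespace BMWPaper

/-- The Coxeter length of a permutation of `Fin n`: the number of inversions. -/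
def len {n : ℕ} (w : Equiv.Perm (Fin n)) : ℕ :=
  (Finset.univ.filter (fun p : Fin n × Fin n => p.1 < p.2 ∧ w p.2 < w p.1)).card

/-- `sGen n i` is the adjacent transposition `s_i = (i, i+1)` (1-based) in `S_n`;
it is the identity for out-of-range `i`. -/
def sGen (n i : ℕ) : Equiv.Perm (Fin n) :=
  if h : 1 ≤ i ∧ i < n then Equiv.swap ⟨i - 1, by omega⟩ ⟨i, h.2⟩ else 1

/-- `pimg d i` is the (1-based) image `(i)d` of the point `i ∈ {1,…,n}` under the
*right* action of the permutation `d` (permutations act on points on the right,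
so that `(a)(στ) = ((a)σ)τ` for the group multiplication `σ * τ`);
the junk value `0` is returned for out-of-range `i`. -/
def pimg {n : ℕ} (d : Equiv.Perm (Fin n)) (i : ℕ) : ℕ :=
  if h : i - 1 < n then ((d⁻¹ ⟨i - 1, h⟩ : Fin n) : ℕ) + 1 else 0

open scoped Classical in
/-- `Hset n f` is the set `H_f(n)` of all `d ∈ S_n` such that
`(1)d < (3)d < ⋯ < (2f-1)d`, `(2i-1)d < (2i)d` for `i = 1,…,f`, and
`(2f+1)d < (2f+2)d < ⋯ < (n)d`. -/
noncomputable def Hset (n f : ℕ) : Finset (Equiv.Perm (Fin n)) :=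
  Finset.univ.filter (fun d =>
    (∀ i ∈ Finset.Icc 1 (f - 1), pimg d (2 * i - 1) < pimg d (2 * i + 1)) ∧
    (∀ i ∈ Finset.Icc 1 f, pimg d (2 * i - 1) < pimg d (2 * i)) ∧
    (∀ j ∈ Finset.Icc (2 * f + 1) (n - 1), pimg d j < pimg d (j + 1)))

/-- The index of the block of the composition `μ` containing the (0-based) point `k`. -/
def blockOf (μ : List ℕ) (k : ℕ) : ℕ :=
  ((List.range μ.length).filter (fun j => (μ.take (j + 1)).sum ≤ k)).length

open scoped Classical in
/-- The Young subgroup `S_μ` of `S_n` associated with a composition `μ` of `n`,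
as the set of permutations preserving each of the consecutive blocks of `μ`. -/
noncomputable def youngSet (n : ℕ) (μ : List ℕ) : Finset (Equiv.Perm (Fin n)) :=
  Finset.univ.filter (fun w => ∀ a : Fin n, blockOf μ ((w a : ℕ)) = blockOf μ (a : ℕ))

open scoped Classical in
/-- The set `D_μ` of minimal-length right coset representatives of `S_μ` in `S_n`:
the elements of minimal length in their right coset `S_μ d`. -/
noncomputable def Dset (n : ℕ) (μ : List ℕ) : Finset (Equiv.Perm (Fin n)) :=
  Finset.univ.filter (fun d => ∀ u ∈ youngSet n μ, len d ≤ len (u * d))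

/-- The identification of `Fin m` with the block `[k, k+m)` of `Fin n` (0-based). -/
def shiftEquiv (n k m : ℕ) (h : k + m ≤ n) :
    Fin m ≃ {a : Fin n // k ≤ (a : ℕ) ∧ (a : ℕ) < k + m} where
  toFun b := ⟨⟨k + (b : ℕ), by have := b.isLt; omega⟩, by
    constructor
    · exact Nat.le_add_right _ _
    · have := b.isLt; simp only [Fin.val_mk]; omega⟩
  invFun a := ⟨(a : Fin n) - k, by have := a.2; omega⟩
  left_inv b := by
    apply Fin.ext
    simp
  right_inv a := by
    apply Subtype.ext
    apply Fin.ext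
    have := a.2
    simp only []
    omega

open scoped Classical in
/-- The embedding of `S_m` into `S_n` as the group of permutations of the
(1-based) block `{k+1, …, k+m}` of `{1, …, n}`. -/
noncomputable def shiftEmb (n k m : ℕ) (w : Equiv.Perm (Fin m)) : Equiv.Perm (Fin n) :=
  if h : k + m ≤ n then w.extendDomain (shiftEquiv n k m h) else 1

open scoped Classical in
/-- The subgroup of `S_n` of permutations fixing the (1-based) points `1, …, k`. -/
noncomputable def fixSet (n k : ℕ) : Finset (Equiv.Perm (Fin n)) :=
  Finset.univ.filter (fun w => ∀ a : Fin n, (a : ℕ) < k → w a = a)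


/-- `bbs n i` is the permutation `𝕤_i = s_{2i} s_{2i-1} s_{2i+1} s_{2i} = (2i-1, 2i+1)(2i, 2i+2)`. -/
def bbs (n i : ℕ) : Equiv.Perm (Fin n) :=
  sGen n (2 * i) * sGen n (2 * i - 1) * sGen n (2 * i + 1) * sGen n (2 * i)

open scoped Classical in
/-- The set `𝔻_{(1,f-1)} = {𝕤_1 𝕤_2 ⋯ 𝕤_k : k = 0, …, f-1}` in `S_{2f}`. -/
noncomputable def bbD1 (f : ℕ) : Finset (Equiv.Perm (Fin (2 * f))) :=
  (Finset.range f).image (fun k => ((List.range k).map (fun j => bbs (2 * f) (j + 1))).prod)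

open scoped Classical in
/-- The set `𝔻_{(1,f-2)}^{{2,…,f}} = {𝕤_2 𝕤_3 ⋯ 𝕤_k : k = 1, …, f-1}` in `S_{2f}`. -/
noncomputable def bbD1' (f : ℕ) : Finset (Equiv.Perm (Fin (2 * f))) :=
  (Finset.Icc 1 (f - 1)).image
    (fun k => ((List.range (k - 1)).map (fun j => bbs (2 * f) (j + 2))).prod)

open scoped Classical in
/-- `H_f^{(a)} = {d ∈ H_f(n) : (1)d⁻¹ = 1, (2)d⁻¹ = 2}`. -/
noncomputable def HsetA (n f : ℕ) : Finset (Equiv.Perm (Fin n)) :=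
  (Hset n f).filter (fun d => pimg d⁻¹ 1 = 1 ∧ pimg d⁻¹ 2 = 2)

open scoped Classical in
/-- `H_f^{(b)} = {d ∈ H_f(n) : (1)d⁻¹ = 1, (2)d⁻¹ = 3}`. -/
noncomputable def HsetB (n f : ℕ) : Finset (Equiv.Perm (Fin n)) :=
  (Hset n f).filter (fun d => pimg d⁻¹ 1 = 1 ∧ pimg d⁻¹ 2 = 3)

open scoped Classical in
/-- `H_f^{(c)} = {d ∈ H_f(n) : (1)d⁻¹ = 1, (2)d⁻¹ = 2f+1}`. -/
noncomputable def HsetC (n f : ℕ) : Finset (Equiv.Perm (Fin n)) :=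
  (Hset n f).filter (fun d => pimg d⁻¹ 1 = 1 ∧ pimg d⁻¹ 2 = 2 * f + 1)

open scoped Classical in
/-- `H_f^{(d)} = {d ∈ H_f(n) : (1)d⁻¹ = 2f+1, (2)d⁻¹ = 1}`. -/
noncomputable def HsetD (n f : ℕ) : Finset (Equiv.Perm (Fin n)) :=
  (Hset n f).filter (fun d => pimg d⁻¹ 1 = 2 * f + 1 ∧ pimg d⁻¹ 2 = 1)

open scoped Classical in
/-- `H_f^{(e)} = {d ∈ H_f(n) : (1)d⁻¹ = 2f+1, (2)d⁻¹ = 2f+2}`. -/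
noncomputable def HsetE (n f : ℕ) : Finset (Equiv.Perm (Fin n)) :=
  (Hset n f).filter (fun d => pimg d⁻¹ 1 = 2 * f + 1 ∧ pimg d⁻¹ 2 = 2 * f + 2)

section Algebra

variable {F : Type*} [Field F] {A : Type*} [Ring A] [Algebra F A]

/-- For a set `S` of permutations, `hat c Tw S = Σ_{w ∈ S} c^{ℓ(w)} T_w`. -/
noncomputable def hat {n : ℕ} (c : F) (Tw : Equiv.Perm (Fin n) → A)
    (S : Finset (Equiv.Perm (Fin n))) : A :=
  ∑ w ∈ S, c ^ len w • Tw w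

/-- `Ehat E f = E_1 E_3 ⋯ E_{2f-1}`. -/
def Ehat (E : ℕ → A) (f : ℕ) : A := ((List.range f).map (fun i => E (2 * i + 1))).prod

/-- `Tprod T a b = T_a T_{a+1} ⋯ T_b` (the empty product `1` if `b < a`). -/
def Tprod (T : ℕ → A) (a b : ℕ) : A := ((List.range (b + 1 - a)).map (fun t => T (a + t))).prod

/-- `sDesc n a b = s_a s_{a-1} ⋯ s_b` (descending product of adjacent transpositions). -/
def sDesc (n a b : ℕ) : Equiv.Perm (Fin n) :=
  ((List.range (a + 1 - b)).map (fun j => sGen n (a - j))).prod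

/-- The data of a Birman–Murakami–Wenzl algebra structure: an `F`-algebra `A`
with invertible elements `T_1, …, T_{n-1}` and elements `E_1, …, E_{n-1}`
satisfying the BMW relations, together with a map `w ↦ T_w` from `S_n` to `A`
with `T_id = 1`, `T_{s_i} = T_i` and `T_{uv} = T_u T_v` whenever lengths add. -/
structure BMWData (F : Type*) [Field F] (A : Type*) [Ring A] [Algebra F A]
    (n : ℕ) (q r : F) where
  T : ℕ → A
  Tinv : ℕ → A
  E : ℕ → A
  Tw : Equiv.Perm (Fin n) → A
  hq : q ≠ 0
  hr : r ≠ 0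
  hqq : q - q⁻¹ ≠ 0
  T_mul_Tinv : ∀ i, 1 ≤ i → i ≤ n - 1 → T i * Tinv i = 1
  Tinv_mul_T : ∀ i, 1 ≤ i → i ≤ n - 1 → Tinv i * T i = 1
  skein : ∀ i, 1 ≤ i → i ≤ n - 1 → T i - Tinv i = (q - q⁻¹) • (1 - E i)
  Esq : ∀ i, 1 ≤ i → i ≤ n - 1 → E i * E i = (1 + (r - r⁻¹) / (q - q⁻¹)) • E i
  braid : ∀ i, 1 ≤ i → i + 1 ≤ n - 1 → T i * T (i + 1) * T i = T (i + 1) * T i * T (i + 1)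
  T_comm : ∀ i j, 1 ≤ i → i ≤ n - 1 → 1 ≤ j → j ≤ n - 1 → (i + 1 < j ∨ j + 1 < i) →
    T i * T j = T j * T i
  EEE₁ : ∀ i, 1 ≤ i → i + 1 ≤ n - 1 → E i * E (i + 1) * E i = E i
  EEE₂ : ∀ i, 1 ≤ i → i + 1 ≤ n - 1 → E (i + 1) * E i * E (i + 1) = E (i + 1)
  TTE₁ : ∀ i, 1 ≤ i → i + 1 ≤ n - 1 → T i * T (i + 1) * E i = E (i + 1) * E i
  TTE₂ : ∀ i, 1 ≤ i → i + 1 ≤ n - 1 → T (i + 1) * T i * E (i + 1) = E i * E (i + 1)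
  ET : ∀ i, 1 ≤ i → i ≤ n - 1 → E i * T i = r⁻¹ • E i
  TE : ∀ i, 1 ≤ i → i ≤ n - 1 → T i * E i = r⁻¹ • E i
  ETE₁ : ∀ i, 1 ≤ i → i + 1 ≤ n - 1 → E i * T (i + 1) * E i = r • E i
  ETE₂ : ∀ i, 1 ≤ i → i + 1 ≤ n - 1 → E (i + 1) * T i * E (i + 1) = r • E (i + 1)
  Tw_one : Tw 1 = 1
  Tw_s : ∀ i, 1 ≤ i → i ≤ n - 1 → Tw (sGen n i) = T i
  Tw_mul : ∀ u v : Equiv.Perm (Fin n), len (u * v) = len u + len v →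
    Tw (u * v) = Tw u * Tw v

/-- The scalars `a_f` defined by `a_0 = 1` and `a_i = a_{i-1} · Σ_{k=0}^{i-1} q^{2k}`. -/
noncomputable def aseq (q : F) : ℕ → F
  | 0 => 1
  | (i + 1) => aseq q i * (∑ k ∈ Finset.range (i + 1), q ^ (2 * k))


/-- The scalars `c_f` defined by `c_0 = 1` and
`c_f = -((q^{4f-3} - q^{2f-3})/(r q^{2n-2f-2} - q⁻¹)) · c_{f-1}`. -/
noncomputable def cseq (q r : F) (n : ℕ) : ℕ → F
  | 0 => 1
  | (f + 1) =>
      -((q ^ (4 * ((f : ℤ) + 1) - 3) - q ^ (2 * ((f : ℤ) + 1) - 3)) /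
          (r * q ^ (2 * (n : ℤ) - 2 * ((f : ℤ) + 1) - 2) - q⁻¹)) * cseq q r n f

/-- The scalars `č_f` defined by `č_0 = 1` and
`č_f = (q^{3-4f}(1 - q^{2f})/(q + r q^{2+2f-2n})) · č_{f-1}` (with integer exponents). -/
noncomputable def ccseq (q r : F) (n : ℕ) : ℕ → F
  | 0 => 1
  | (f + 1) =>
      (q ^ ((3 : ℤ) - 4 * ((f : ℤ) + 1)) * (1 - q ^ (2 * (f + 1))) /
          (q + r * q ^ ((2 : ℤ) + 2 * ((f : ℤ) + 1) - 2 * (n : ℤ)))) * ccseq q r n f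

/-- The element `x_f = (H_f⁻¹)^ · Ŝ_{{2f+1,…,n}} · Ê_f · Ĥ_f` of the BMW algebra. -/
noncomputable def xEl {F : Type*} [Field F] {A : Type*} [Ring A] [Algebra F A]
    {n : ℕ} {q r : F} (D : BMWData F A n q r) (f : ℕ) : A :=
  hat q D.Tw ((Hset n f).image (fun d => d⁻¹)) * hat q D.Tw (fixSet n (2 * f)) *
    Ehat D.E f * hat q D.Tw (Hset n f)

/-- The element `x̌_f = (H_f⁻¹)ˇ · Š_{{2f+1,…,n}} · Ê_f · Ȟ_f` of the BMW algebra,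
where `ˇ` is formed with `-q⁻¹` in place of `q`. -/
noncomputable def xElCheck {F : Type*} [Field F] {A : Type*} [Ring A] [Algebra F A]
    {n : ℕ} {q r : F} (D : BMWData F A n q r) (f : ℕ) : A :=
  hat (-q⁻¹) D.Tw ((Hset n f).image (fun d => d⁻¹)) * hat (-q⁻¹) D.Tw (fixSet n (2 * f)) *
    Ehat D.E f * hat (-q⁻¹) D.Tw (Hset n f)

end Algebra

section Length

variable {n : ℕ}

/-- Right multiplication by `s_k` at an ascent raises the length by one. -/
theorem len_mul_sGen (w : Equiv.Perm (Fin n)) {k : ℕ} (hk : 1 ≤ k) (hkn : k < n)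
    (h : w ⟨k - 1, by omega⟩ < w ⟨k, hkn⟩) : len (w * sGen n k) = len w + 1 := by
  classical
  set a : Fin n := ⟨k - 1, by omega⟩ with ha
  set b : Fin n := ⟨k, hkn⟩ with hb
  have hs : sGen n k = Equiv.swap a b := by simp [sGen, hk, hkn, ha, hb]
  have hab : (b : ℕ) = a + 1 := by simp only [ha, hb]; omega
  set s := Equiv.swap a b with hsdef
  have hss : ∀ x, s (s x) = x := Equiv.swap_apply_self a b
  have mono : ∀ x y : Fin n, x < y → (x, y) ≠ (a, b) → s x < s y := by
    intro x y hxy hne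
    simp only [ne_eq, Prod.mk.injEq, not_and, Fin.ext_iff] at hne
    simp only [hsdef, Equiv.swap_apply_def, Fin.lt_def, Fin.ext_iff] at hxy ⊢
    split_ifs <;> omega
  have key : (univ.filter fun p : Fin n × Fin n => p.1 < p.2 ∧ (w * s) p.2 < (w * s) p.1) =
      insert (a, b) ((univ.filter fun p : Fin n × Fin n => p.1 < p.2 ∧ w p.2 < w p.1).image
        (Prod.map s s)) := by
    ext ⟨x, y⟩
    rw [mem_insert, mem_image, mem_filter_univ]
    simp only [mem_filter_univ, Equiv.Perm.mul_apply]
    constructor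
    · rintro ⟨hxy, hw⟩
      by_cases hne : (x, y) = (a, b)
      · exact Or.inl hne
      · exact Or.inr ⟨(s x, s y), ⟨mono x y hxy hne, hw⟩, by simp [hss]⟩
    · rintro (hxy | ⟨⟨x', y'⟩, ⟨hxy, hw⟩, he⟩)
      · obtain ⟨rfl, rfl⟩ := Prod.mk.inj hxy
        refine ⟨Fin.lt_def.2 (by omega), ?_⟩
        simpa [hsdef] using h
      · obtain ⟨rfl, rfl⟩ := Prod.mk.inj he
        refine ⟨mono _ _ hxy ?_, by simpa [hss] using hw⟩
        rintro hne
        obtain ⟨rfl, rfl⟩ := Prod.mk.inj hne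
        exact lt_asymm h hw
  rw [hs, len, key, card_insert_of_notMem, card_image_of_injective _
    (s.injective.prodMap s.injective), len]
  simp only [mem_image, mem_filter, mem_univ, true_and, not_exists, not_and]
  rintro ⟨x, y⟩ ⟨hxy, -⟩ he
  obtain ⟨hx, hy⟩ := Prod.mk.inj he
  have hx' : x = b := by rw [← hss x, show s x = a from hx]; simp [hsdef]
  have hy' : y = a := by rw [← hss y, show s y = b from hy]; simp [hsdef]
  simp only [hx', hy', Fin.lt_def] at hxy
  omega

theorem len_sGen {k : ℕ} (hk : 1 ≤ k) (hkn : k < n) : len (sGen n k) = 1 := by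
  have h := len_mul_sGen (1 : Equiv.Perm (Fin n)) hk hkn (Fin.lt_def.2 (by simp; omega))
  have h1 : len (1 : Equiv.Perm (Fin n)) = 0 := by
    rw [len, card_eq_zero, filter_eq_empty_iff]
    rintro p - ⟨hp, hp'⟩
    exact lt_asymm hp hp'
  simpa [h1] using h

theorem sGen_apply {k : ℕ} (hk : 1 ≤ k) (hkn : k < n) (x : Fin n) :
    sGen n k x = Equiv.swap ⟨k - 1, by omega⟩ ⟨k, hkn⟩ x := by
  simp [sGen, hk, hkn]

theorem sGen_mul_self (n k : ℕ) : sGen n k * sGen n k = 1 := by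
  unfold sGen
  split_ifs <;> simp

theorem mem_image_mul_sGen {k : ℕ} {S : Finset (Equiv.Perm (Fin n))} {w : Equiv.Perm (Fin n)} :
    w ∈ S.image (· * sGen n k) ↔ w * sGen n k ∈ S := by
  constructor
  · intro h
    obtain ⟨u, hu, rfl⟩ := mem_image.1 h
    simpa [mul_assoc, sGen_mul_self] using hu
  · exact fun h => mem_image.2 ⟨_, h, by simp [mul_assoc, sGen_mul_self]⟩

/-- The set of permutations with an ascent at `k`. -/
def ascents (n k : ℕ) (hkn : k < n) : Finset (Equiv.Perm (Fin n)) :=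
  univ.filter fun w => w ⟨k - 1, by omega⟩ < w ⟨k, hkn⟩

/-- The set of permutations with ascents at `k` and `k + 1`. -/
def doubleAscents (n k : ℕ) (hkn : k + 1 < n) : Finset (Equiv.Perm (Fin n)) :=
  univ.filter fun w => w ⟨k - 1, by omega⟩ < w ⟨k, by omega⟩ ∧ w ⟨k, by omega⟩ < w ⟨k + 1, hkn⟩

end Length

section Tprod

variable {A : Type*} [Ring A]

theorem Tprod_succ (T : ℕ → A) {a b : ℕ} (h : a ≤ b + 1) :
    Tprod T a (b + 1) = Tprod T a b * T (b + 1) := by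
  rw [Tprod, show b + 1 + 1 - a = (b + 1 - a) + 1 by omega, List.range_succ, List.map_append,
    List.prod_append, Tprod]
  simp [show a + (b + 1 - a) = b + 1 by omega]

end Tprod

theorem hat_union {F : Type*} [Field F] {A : Type*} [Ring A] [Algebra F A] {n : ℕ} {c : F}
    {Tw : Equiv.Perm (Fin n) → A} {S S' : Finset (Equiv.Perm (Fin n))} (h : Disjoint S S') :
    hat c Tw (S ∪ S') = hat c Tw S + hat c Tw S' :=
  sum_union h

namespace BMWData

variable {F : Type*} [Field F] {A : Type*} [Ring A] [Algebra F A] {n : ℕ} {q r : F}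
  (D : BMWData F A n q r)

theorem Tw_mul_sGen (w : Equiv.Perm (Fin n)) {k : ℕ} (hk : 1 ≤ k) (hkn : k < n)
    (h : w ⟨k - 1, by omega⟩ < w ⟨k, hkn⟩) : D.Tw (w * sGen n k) = D.Tw w * D.T k := by
  rw [D.Tw_mul _ _ (by rw [len_sGen hk hkn, len_mul_sGen w hk hkn h]), D.Tw_s k hk (by omega)]

/-- Translating a set of permutations with an ascent at `k` by `s_k` multiplies its `hat` sum
by `q T_k`. -/
theorem hat_image_mul_sGen {k : ℕ} (hk : 1 ≤ k) (hkn : k < n) (S : Finset (Equiv.Perm (Fin n)))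
    (hS : ∀ w ∈ S, w ⟨k - 1, by omega⟩ < w ⟨k, hkn⟩) :
    hat q D.Tw (S.image (· * sGen n k)) = q • (hat q D.Tw S * D.T k) := by
  rw [hat, sum_image (fun _ _ _ _ h => mul_right_cancel h), hat, sum_mul, smul_sum]
  refine sum_congr rfl fun w hw => ?_
  rw [D.Tw_mul_sGen w hk hkn (hS w hw), len_mul_sGen w hk hkn (hS w hw), smul_mul_assoc,
    smul_smul, pow_succ']

theorem hat_univ_eq {k : ℕ} (hk : 1 ≤ k) (hkn : k < n) :
    hat q D.Tw univ = hat q D.Tw (ascents n k hkn) * (1 + q • D.T k) := by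
  have hne : (⟨k - 1, by omega⟩ : Fin n) ≠ ⟨k, hkn⟩ := by simp; omega
  have hS : ∀ w ∈ ascents n k hkn, w ⟨k - 1, by omega⟩ < w ⟨k, hkn⟩ := by simp [ascents]
  rw [mul_add, mul_one, mul_smul_comm, ← D.hat_image_mul_sGen hk hkn _ hS, ← hat_union]
  · congr 1
    ext w
    have h := (w.injective.ne hne).lt_or_gt
    rw [mem_union, mem_image_mul_sGen]
    simp only [ascents, mem_filter_univ, mem_univ, true_iff, Equiv.Perm.mul_apply,
      sGen_apply hk hkn, Equiv.swap_apply_left, Equiv.swap_apply_right]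
    exact h
  · rw [disjoint_left]
    intro w hw
    simp only [mem_image_mul_sGen, ascents, mem_filter, mem_univ, true_and] at hw ⊢
    simpa [sGen_apply hk hkn] using hw.le

theorem hat_ascents_eq {k : ℕ} (hk : 1 ≤ k) (hkn : k + 1 < n) :
    hat q D.Tw (ascents n k (by omega)) = hat q D.Tw (doubleAscents n k hkn) *
      (1 + q • D.T (k + 1) + q ^ 2 • (D.T k * D.T (k + 1))) := by
  set a : Fin n := ⟨k - 1, by omega⟩ with ha
  set b : Fin n := ⟨k, by omega⟩ with hb
  set c : Fin n := ⟨k + 1, hkn⟩ with hc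
  have hab : a ≠ b := by simp [ha, hb]; omega
  have hbc : b ≠ c := by simp [hb, hc]
  have hac : a ≠ c := by simp [ha, hc]
  have s1 : ∀ x, sGen n k x = Equiv.swap a b x := sGen_apply hk (by omega)
  have s2 : ∀ x, sGen n (k + 1) x = Equiv.swap b c x := sGen_apply (by omega) hkn
  have e1 : sGen n k a = b := by simp [s1]
  have e2 : sGen n k b = a := by simp [s1]
  have e3 : sGen n k c = c := by rw [s1, Equiv.swap_apply_of_ne_of_ne hac.symm hbc.symm]
  have f1 : sGen n (k + 1) a = a := by rw [s2, Equiv.swap_apply_of_ne_of_ne hab hac]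
  have f2 : sGen n (k + 1) b = c := by simp [s2]
  have f3 : sGen n (k + 1) c = b := by simp [s2]
  set P := doubleAscents n k hkn with hP
  have memP : ∀ w, w ∈ P ↔ w a < w b ∧ w b < w c := by simp [hP, doubleAscents, ha, hb, hc]
  have mem1 : ∀ w, w ∈ P.image (· * sGen n (k + 1)) ↔ w a < w c ∧ w c < w b := by
    intro w
    rw [mem_image_mul_sGen, memP]
    simp [f1, f2, f3]
  have mem2 : ∀ w, w ∈ P.image (· * sGen n k) ↔ w b < w a ∧ w a < w c := by
    intro w
    rw [mem_image_mul_sGen, memP]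
    simp [e1, e2, e3]
  have mem3 : ∀ w, w ∈ (P.image (· * sGen n k)).image (· * sGen n (k + 1)) ↔
      w c < w a ∧ w a < w b := by
    intro w
    rw [mem_image_mul_sGen, mem2]
    simp [f1, f2, f3]
  have h1 := D.hat_image_mul_sGen (k := k + 1) (by omega) hkn P fun w hw => ((memP w).1 hw).2
  have h2 := D.hat_image_mul_sGen hk (by omega) P fun w hw => ((memP w).1 hw).1
  have h3 := D.hat_image_mul_sGen (k := k + 1) (by omega) hkn (P.image (· * sGen n k))
    fun w hw => ((mem2 w).1 hw).1.trans ((mem2 w).1 hw).2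
  have hset : ascents n k (by omega) = (P ∪ P.image (· * sGen n (k + 1))) ∪
      (P.image (· * sGen n k)).image (· * sGen n (k + 1)) := by
    ext w
    have hbc' := w.injective.ne hbc
    have hac' := w.injective.ne hac
    rw [mem_union, mem_union, memP, mem1, mem3]
    simp only [ascents, mem_filter, mem_univ, true_and, ← ha, ← hb]
    omega
  rw [hset, hat_union, hat_union, h1, h3, h2]
  · simp only [mul_add, mul_one, mul_smul_comm, smul_mul_assoc, smul_smul, pow_two, mul_assoc]
  · rw [disjoint_left]
    intro w hw
    rw [memP] at hw
    rw [mem1]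
    omega
  · rw [disjoint_left]
    intro w hw
    rw [mem_union, memP, mem1] at hw
    rw [mem3]
    omega

theorem T_mul_T {k : ℕ} (hk : 1 ≤ k) (hkn : k ≤ n - 1) :
    D.T k * D.T k = 1 + (q - q⁻¹) • (D.T k - r⁻¹ • D.E k) := by
  have h := congrArg (D.T k * ·) (D.skein k hk hkn)
  simp only [mul_sub, D.T_mul_Tinv k hk hkn, mul_smul_comm, mul_one, D.TE k hk hkn] at h
  rw [← h]
  abel

theorem E_mul_T_mul_T {k : ℕ} (hk : 1 ≤ k) (hkn : k + 1 ≤ n - 1) :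
    D.E k * D.T (k + 1) * D.T k = D.E k * D.E (k + 1) := by
  rw [← D.TTE₂ k hk hkn]
  have hb := D.braid k hk hkn
  have hinv : D.T (k + 1) * D.T k * D.Tinv (k + 1) = D.Tinv k * (D.T (k + 1) * D.T k) := by
    calc _ = D.Tinv k * (D.T k * D.T (k + 1) * D.T k) * D.Tinv (k + 1) := by
          simp only [← mul_assoc, D.Tinv_mul_T k hk (by omega), one_mul]
      _ = _ := by
          rw [hb]
          simp only [mul_assoc, D.T_mul_Tinv (k + 1) (by omega) hkn, mul_one]
  have h : (q - q⁻¹) • ((1 - D.E k) * (D.T (k + 1) * D.T k)) =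
      (q - q⁻¹) • (D.T (k + 1) * D.T k * (1 - D.E (k + 1))) := by
    rw [← smul_mul_assoc, ← mul_smul_comm, ← D.skein k hk (by omega),
      ← D.skein (k + 1) (by omega) hkn, sub_mul, mul_sub, hinv, ← mul_assoc, hb]
  have h' := smul_right_injective A D.hqq h
  simpa [sub_mul, mul_sub, mul_assoc] using h'

theorem hat_mul_T (hrq : r + q ≠ 0) {k : ℕ} (hk : 1 ≤ k) (hkn : k ≤ n - 1) :
    hat q D.Tw univ * D.T k =
      q • hat q D.Tw univ + ((1 - q ^ 2) / (r + q)) • (hat q D.Tw univ * D.E k) := by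
  have hq := D.hq
  have hr := D.hr
  have key : (1 + q • D.T k) * D.T k =
      q • (1 + q • D.T k) + ((1 - q ^ 2) / (r + q)) • ((1 + q • D.T k) * D.E k) := by
    simp only [add_mul, one_mul, smul_mul_assoc, D.T_mul_T hk hkn, D.TE k hk hkn]
    match_scalars <;> field_simp <;> ring
  rw [D.hat_univ_eq hk (by omega), mul_assoc, key, mul_add, mul_smul_comm, mul_smul_comm, mul_assoc]

theorem hat_mul_E_mul_E {k : ℕ} (hk : 1 ≤ k) (hkn : k + 1 ≤ n - 1) :
    hat q D.Tw univ * (D.E k * D.E (k + 1)) = hat q D.Tw univ * D.E (k + 1) := by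
  have hq := D.hq
  have hr := D.hr
  rw [D.hat_univ_eq (k := k) hk (by omega), D.hat_ascents_eq hk (by omega)]
  have hb := D.braid k hk hkn
  have hTT := D.TTE₂ k hk hkn
  have hTE := D.TE k hk (by omega)
  have hTE' := D.TE (k + 1) (by omega) hkn
  have hTTEE : D.T k * D.T (k + 1) * D.E k * D.E (k + 1) = D.E (k + 1) := by
    rw [D.TTE₁ k hk hkn, D.EEE₂ k hk hkn]
  have hTEE : D.T (k + 1) * D.E k * D.E (k + 1) = D.T k * D.E (k + 1) -
      (q - q⁻¹) • (D.E (k + 1) - D.E k * D.E (k + 1)) := by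
    calc _ = D.Tinv k * (D.T k * D.T (k + 1) * D.E k * D.E (k + 1)) := by
          simp only [← mul_assoc, D.Tinv_mul_T k hk (by omega), one_mul]
      _ = (D.T k - (q - q⁻¹) • (1 - D.E k)) * D.E (k + 1) := by
          rw [hTTEE, ← D.skein k hk (by omega), sub_sub_cancel]
      _ = _ := by rw [sub_mul, smul_mul_assoc, sub_mul, one_mul]
  generalize D.T k = t at *
  generalize D.T (k + 1) = t' at *
  generalize D.E k = e at *
  generalize D.E (k + 1) = e' at *
  have hswap : (1 + q • t' + q ^ 2 • (t * t')) * (1 + q • t) =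
      (1 + q • t + q ^ 2 • (t' * t)) * (1 + q • t') := by
    simp only [mul_add, add_mul, mul_one, one_mul, smul_mul_assoc, mul_smul_comm, hb]
    module
  have hl : (1 + q • t) * e = (1 + q * r⁻¹) • e := by
    rw [add_mul, one_mul, smul_mul_assoc, hTE]
    module
  have hl' : (1 + q • t') * e' = (1 + q * r⁻¹) • e' := by
    rw [add_mul, one_mul, smul_mul_assoc, hTE']
    module
  have key : (1 + q • t' + q ^ 2 • (t * t')) * (1 + q • t) * (e * e') =
      (1 + q • t' + q ^ 2 • (t * t')) * (1 + q • t) * e' := by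
    conv_rhs => rw [hswap, mul_assoc, hl']
    rw [mul_assoc, ← mul_assoc (1 + q • t) e, hl]
    simp only [add_mul, one_mul, smul_mul_assoc, mul_smul_comm, ← mul_assoc, hTEE, hTTEE, hTT]
    match_scalars <;> field_simp <;> ring
  rw [mul_assoc _ _ (1 + q • t), mul_assoc, key, ← mul_assoc]

theorem T_mul_Tprod_comm {m : ℕ} (hm : m ≤ n - 1) {j : ℕ} (hj : j + 1 < m) :
    Tprod D.T 1 j * D.T m = D.T m * Tprod D.T 1 j := by
  induction j with
  | zero => simp [Tprod]
  | succ j ih =>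
    rw [Tprod_succ _ (by omega), mul_assoc,
      D.T_comm (j + 1) m (by omega) (by omega) (by omega) hm (by omega), ← mul_assoc,
      ih (by omega), mul_assoc]

theorem hat_mul_E_mul_Tprod {k : ℕ} (hk : 1 ≤ k) (hkn : k ≤ n - 1) :
    hat q D.Tw univ * D.E 1 * (Tprod D.T 2 k * Tprod D.T 1 (k - 1)) =
      hat q D.Tw univ * D.E k := by
  induction k, hk using Nat.le_induction with
  | base => simp [Tprod]
  | succ k hk ih =>
    obtain ⟨m, rfl⟩ : ∃ m, k = m + 1 := ⟨k - 1, by omega⟩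
    have hcomm := D.T_mul_Tprod_comm (m := m + 1 + 1) hkn (j := m) (by omega)
    have h := ih (by omega)
    rw [Nat.add_sub_cancel] at h ⊢
    calc _ = hat q D.Tw univ * D.E 1 * (Tprod D.T 2 (m + 1) * Tprod D.T 1 m) *
          (D.T (m + 1 + 1) * D.T (m + 1)) := by
          rw [Tprod_succ D.T (a := 2) (by omega), Tprod_succ D.T (a := 1) (by omega)]
          simp only [mul_assoc]
          rw [← mul_assoc (D.T (m + 1 + 1)), ← hcomm]
          simp only [mul_assoc]
      _ = hat q D.Tw univ * D.E (m + 1 + 1) := by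
          rw [h, mul_assoc, ← mul_assoc (D.E (m + 1)), D.E_mul_T_mul_T hk hkn,
            D.hat_mul_E_mul_E hk hkn]

end BMWData

/-- If `r + q ≠ 0` then for `1 ≤ i ≤ n`,
`Ŝ_n · T_1⋯T_{i-1} = q^{i-1} Ŝ_n + ((1-q²)/(r+q)) · Ŝ_n · E_1 ·
Σ_{j=1}^{i-1} q^{j-1} T_2⋯T_{i-1} T_1⋯T_{j-1}`. -/
theorem statement3 {F : Type*} [Field F] {A : Type*} [Ring A] [Algebra F A]
    {n : ℕ} (hn : 1 ≤ n) {q r : F} (D : BMWData F A n q r)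
    (hrq : r + q ≠ 0) (i : ℕ) (h1 : 1 ≤ i) (h2 : i ≤ n) :
    hat q D.Tw (Finset.univ : Finset (Equiv.Perm (Fin n))) * Tprod D.T 1 (i - 1) =
      q ^ (i - 1) • hat q D.Tw (Finset.univ : Finset (Equiv.Perm (Fin n))) +
      ((1 - q ^ 2) / (r + q)) •
        (hat q D.Tw (Finset.univ : Finset (Equiv.Perm (Fin n))) * D.E 1 *
          ∑ j ∈ Finset.Icc 1 (i - 1),
            q ^ (j - 1) • (Tprod D.T 2 (i - 1) * Tprod D.T 1 (j - 1))) := by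
  induction i, h1 using Nat.le_induction with
  | base => simp [Tprod]
  | succ i hi ih =>
    obtain ⟨m, rfl⟩ : ∃ m, i = m + 1 := ⟨i - 1, by omega⟩
    have ih := ih (by omega)
    have hE := D.hat_mul_E_mul_Tprod hi (by omega)
    rw [Nat.add_sub_cancel] at ih hE ⊢
    have hsum : ∑ j ∈ Finset.Icc 1 m, q ^ (j - 1) • (Tprod D.T 2 (m + 1) * Tprod D.T 1 (j - 1)) =
        (∑ j ∈ Finset.Icc 1 m, q ^ (j - 1) • (Tprod D.T 2 m * Tprod D.T 1 (j - 1))) *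
          D.T (m + 1) := by
      rw [Finset.sum_mul]
      refine Finset.sum_congr rfl fun j hj => ?_
      rw [Finset.mem_Icc] at hj
      rw [Tprod_succ D.T (by omega), smul_mul_assoc, mul_assoc, mul_assoc,
        D.T_mul_Tprod_comm (by omega) (by omega)]
    rw [Tprod_succ D.T (a := 1) (by omega), ← mul_assoc, ih, Finset.sum_Icc_succ_top (by omega),
      hsum, Nat.add_sub_cancel, mul_add, mul_smul_comm, hE, add_mul, smul_mul_assoc,
      D.hat_mul_T hrq hi (by omega), smul_mul_assoc, mul_assoc _ _ (D.T (m + 1))]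
    module

end BMWPaper
end

section
/- Let 0 ≤ 2f ≤ n. Then H_f(n) = H_f^{{1,…,2f}} · D_{(2f,n−2f)}: every element d ∈ H_f(n) can be written uniquely as d = u·v with u in the image of H_f(2f) under the embedding of S_{2f} into S_n as the permutations of {1,…,2f} and v ∈ D_{(2f,n−2f)}, and then ℓ(d) = ℓ(u) + ℓ(v); conversely every such product u·v lies in H_f(n). -/
open Finset
open scoped Pointwise

namespace BMWPaper

/-- `b` is strictly increasing on each of the blocks `{a | a < m}` and `{a | m ≤ a}`. -/
def BlockMono {n : ℕ} (m : ℕ) (b : Fin n → Fin n) : Prop :=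
  ∀ i j : Fin n, i < j → ((i : ℕ) < m ↔ (j : ℕ) < m) → b i < b j

theorem blockMono_of_adjacent {n m : ℕ} {b : Fin n → Fin n}
    (hb : ∀ (i : ℕ) (hi : i + 1 < n), i + 1 ≠ m → b ⟨i, by omega⟩ < b ⟨i + 1, hi⟩) :
    BlockMono m b := by
  have key : ∀ (k i : ℕ) (hi : i + k + 1 < n), (i < m ↔ i + k + 1 < m) →
      b ⟨i, by omega⟩ < b ⟨i + k + 1, hi⟩ := by
    intro k
    induction k with
    | zero => intro i hi hm; exact hb i hi (by omega)
    | succ k ih =>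
      intro i hi hm
      exact (ih i (by omega) (by omega)).trans (hb (i + k + 1) hi (by omega))
  rintro ⟨i, hi⟩ ⟨j, hj⟩ hij hm
  simp only [Fin.mk_lt_mk] at hij hm
  obtain ⟨k, rfl⟩ := Nat.exists_eq_add_of_lt hij
  exact key k i hj hm

theorem len_inv {n : ℕ} (w : Equiv.Perm (Fin n)) : len w⁻¹ = len w := by
  unfold len
  refine Finset.card_bij' (fun p _ => (w⁻¹ p.2, w⁻¹ p.1)) (fun p _ => (w p.2, w p.1)) ?_ ?_ ?_ ?_
  all_goals simp +contextual

theorem eq_one_of_len_eq_zero {n : ℕ} {w : Equiv.Perm (Fin n)} (hw : len w = 0) : w = 1 := by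
  have hmono : StrictMono w := by
    intro i j hij
    by_contra hlt
    have hne : w j ≠ w i := fun e => hij.ne' (w.injective e)
    have hmem : (i, j) ∈ Finset.univ.filter
        (fun p : Fin n × Fin n => p.1 < p.2 ∧ w p.2 < w p.1) := by
      simpa [hij] using lt_of_le_of_ne (not_lt.mp hlt) hne
    rw [Finset.card_eq_zero.mp hw] at hmem
    simp at hmem
  have hid : hmono.orderIsoOfSurjective _ w.surjective = OrderIso.refl (Fin n) :=
    Subsingleton.elim _ _
  ext a
  exact congrArg (fun e : Fin n ≃o Fin n => (e a : ℕ)) hid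

theorem len_mul_of_blockMono {n m : ℕ} {u v : Equiv.Perm (Fin n)}
    (hu : ∀ a, (u a : ℕ) < m ↔ (a : ℕ) < m) (hv : BlockMono m ⇑v⁻¹) :
    len (u * v) = len u + len v := by
  have hc : ∀ a, ((u⁻¹ a : Fin n) : ℕ) < m ↔ (a : ℕ) < m := fun a => by
    rw [← hu]; simp
  rw [← len_inv (u * v), ← len_inv u, ← len_inv v, mul_inv_rev]
  generalize u⁻¹ = c at *
  generalize v⁻¹ = b at *
  have hcc : ∀ a, c (c⁻¹ a) = a := fun a => by simp
  have hb : ∀ i j : Fin n, ((i : ℕ) < m ↔ (j : ℕ) < m) → (b i < b j ↔ i < j) := by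
    intro i j hij
    rcases lt_trichotomy i j with h | rfl | h
    · simp [h, hv i j h hij]
    · simp
    · simp [h.not_gt, (hv j i h hij.symm).not_gt]
  unfold len
  rw [← Finset.card_filter_add_card_filter_not
    (fun p : Fin n × Fin n => ((p.1 : ℕ) < m ↔ (p.2 : ℕ) < m))]
  congr 1
  · congr 1
    ext ⟨p, q⟩
    simp only [Finset.mem_filter, Finset.mem_univ, true_and]
    simp only [Equiv.Perm.mul_apply]
    have hp := hc p
    have hq := hc q
    constructor
    · rintro ⟨⟨hpq, hlt⟩, hm⟩
      exact ⟨hpq, (hb _ _ (by rw [hp, hq, hm])).mp hlt⟩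
    · rintro ⟨hpq, hlt⟩
      have hm : (p : ℕ) < m ↔ (q : ℕ) < m := by
        rw [Fin.lt_def] at hpq hlt; omega
      exact ⟨⟨hpq, (hb _ _ (by rw [hp, hq, hm])).mpr hlt⟩, hm⟩
  · refine Finset.card_bij' (fun p _ => (c p.1, c p.2)) (fun p _ => (c⁻¹ p.1, c⁻¹ p.2)) ?_ ?_ ?_ ?_
    · rintro ⟨p, q⟩
      simp only [Finset.mem_filter, Finset.mem_univ, true_and]
      simp only [Equiv.Perm.mul_apply]
      rintro ⟨⟨hpq, hlt⟩, hm⟩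
      refine ⟨?_, hlt⟩
      have hp := hc p
      have hq := hc q
      rw [Fin.lt_def] at hpq ⊢
      omega
    · rintro ⟨p, q⟩
      simp only [Finset.mem_filter, Finset.mem_univ, true_and]
      simp only [Equiv.Perm.mul_apply, hcc]
      rintro ⟨hpq, hlt⟩
      have hm : ¬ ((p : ℕ) < m ↔ (q : ℕ) < m) := fun hm =>
        hpq.not_gt ((hb q p hm.symm).mp hlt)
      have hp := hc (c⁻¹ p)
      have hq := hc (c⁻¹ q)
      simp only [hcc] at hp hq
      refine ⟨⟨?_, hlt⟩, ?_⟩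
      · rw [Fin.lt_def] at hpq ⊢; omega
      · omega
    · simp
    · simp

/-- If left multiplication by an adjacent transposition `s_i` does not shorten `v`, then
`v⁻¹` has no descent at `i`. -/
theorem inv_lt_of_len_le_swap_mul {n : ℕ} {v : Equiv.Perm (Fin n)} {i j : Fin n}
    (hij : (j : ℕ) = i + 1) (hlen : len v ≤ len (Equiv.swap i j * v)) : v⁻¹ i < v⁻¹ j := by
  have hne : i ≠ j := by rintro rfl; omega
  by_contra hlt
  have hdesc : v⁻¹ j < v⁻¹ i :=
    lt_of_le_of_ne (not_lt.mp hlt) fun e => hne (v⁻¹.injective e).symm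
  rw [← len_inv v, ← len_inv (Equiv.swap i j * v), mul_inv_rev, Equiv.swap_inv] at hlen
  generalize v⁻¹ = b at *
  refine hlen.not_gt ?_
  unfold len
  have hmem : (i, j) ∈ Finset.univ.filter
      (fun p : Fin n × Fin n => p.1 < p.2 ∧ b p.2 < b p.1) := by
    have hlt' : i < j := by rw [Fin.lt_def]; omega
    simp [hdesc, hlt']
  rw [← Finset.card_erase_add_one hmem, Nat.lt_succ_iff]
  refine Finset.card_le_card_of_injOn
    (fun p => (Equiv.swap i j p.1, Equiv.swap i j p.2)) ?_ ?_
  · rintro ⟨p, q⟩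
    simp only [Finset.mem_coe, Finset.mem_erase, Finset.mem_filter, Finset.mem_univ, true_and,
      ne_eq, Prod.mk.injEq]
    simp only [Equiv.Perm.mul_apply]
    rintro ⟨hpq, hinv⟩
    have hpq' : ¬ (p = i ∧ q = j) := by
      rintro ⟨rfl, rfl⟩
      simp only [Equiv.swap_apply_left, Equiv.swap_apply_right] at hinv
      exact hinv.not_gt hdesc
    refine ⟨?_, ?_, hinv⟩
    · simp only [Equiv.swap_apply_def]
      simp only [Fin.ext_iff] at hpq' hne ⊢
      split_ifs <;> simp only [Fin.lt_def] at hpq ⊢ <;> omega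
    · simp only [Equiv.swap_apply_def]
      simp only [Fin.ext_iff] at hpq' hne ⊢
      rw [Fin.lt_def] at hpq
      split_ifs <;> omega
  · rintro ⟨p, q⟩ _ ⟨p', q'⟩ _ he
    simpa using he

theorem mem_youngSet_two_iff {n m : ℕ} (hm : m ≤ n) {u : Equiv.Perm (Fin n)} :
    u ∈ youngSet n [m, n - m] ↔ ∀ a, (u a : ℕ) < m ↔ (a : ℕ) < m := by
  have hblock : ∀ a : Fin n, blockOf [m, n - m] a = if (a : ℕ) < m then 0 else 1 := by
    intro a
    have ha : ¬ n ≤ (a : ℕ) := a.isLt.not_ge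
    by_cases hlt : (a : ℕ) < m
    · simp [blockOf, List.range_succ, hm, ha, hlt]
    · simp [blockOf, List.range_succ, hm, ha, hlt, not_lt.mp hlt]
  simp only [youngSet, Finset.mem_filter, Finset.mem_univ, true_and, hblock]
  refine forall_congr' fun a => ?_
  split_ifs <;> simp [*]

theorem mem_Dset_two_iff {n m : ℕ} (hm : m ≤ n) {v : Equiv.Perm (Fin n)} :
    v ∈ Dset n [m, n - m] ↔ BlockMono m ⇑v⁻¹ := by
  simp only [Dset, Finset.mem_filter, Finset.mem_univ, true_and]
  constructor
  · intro hv
    refine blockMono_of_adjacent fun i hi him => ?_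
    refine inv_lt_of_len_le_swap_mul rfl (hv _ ((mem_youngSet_two_iff hm).mpr fun a => ?_))
    rw [Equiv.swap_apply_def]
    split_ifs with h1 h2
    · subst h1; simp only; omega
    · subst h2; simp only; omega
    · rfl
  · intro hv u hu
    rw [len_mul_of_blockMono ((mem_youngSet_two_iff hm).mp hu) hv]
    omega

theorem lt_iff_of_fixes {n m : ℕ} {u : Equiv.Perm (Fin n)}
    (hu : ∀ a : Fin n, m ≤ (a : ℕ) → u a = a) (a : Fin n) : (u a : ℕ) < m ↔ (a : ℕ) < m := by
  constructor
  · intro h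
    by_contra ha
    rw [hu a (not_lt.mp ha)] at h
    exact ha h
  · intro h
    by_contra ha
    have := u.injective (hu (u a) (not_lt.mp ha))
    rw [this] at ha
    exact ha h

theorem inv_fixes {n m : ℕ} {u : Equiv.Perm (Fin n)}
    (hu : ∀ a : Fin n, m ≤ (a : ℕ) → u a = a) (a : Fin n) (ha : m ≤ (a : ℕ)) : u⁻¹ a = a := by
  rw [Equiv.Perm.inv_eq_iff_eq, hu a ha]

theorem shiftEmb_fixes {n m : ℕ} (hm : m ≤ n) (w : Equiv.Perm (Fin m)) (a : Fin n)
    (ha : m ≤ (a : ℕ)) : shiftEmb n 0 m w a = a := by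
  rw [shiftEmb, dif_pos (by omega)]
  exact Equiv.Perm.extendDomain_apply_not_subtype _ _ (by omega)

theorem shiftEmb_inv_castLE {n m : ℕ} (hm : m ≤ n) (w : Equiv.Perm (Fin m)) (b : Fin m) :
    (shiftEmb n 0 m w)⁻¹ (Fin.castLE hm b) = Fin.castLE hm (w⁻¹ b) := by
  have hcast : ∀ c : Fin m, Fin.castLE hm c = (shiftEquiv n 0 m (by omega) c : Fin n) := by
    intro c; ext; simp [shiftEquiv]
  rw [shiftEmb, dif_pos (by omega), Equiv.Perm.extendDomain_inv, hcast, hcast,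
    Equiv.Perm.extendDomain_apply_image]

theorem exists_shiftEmb_eq {n m : ℕ} (hm : m ≤ n) {u : Equiv.Perm (Fin n)}
    (hu : ∀ a : Fin n, m ≤ (a : ℕ) → u a = a) : ∃ w, shiftEmb n 0 m w = u := by
  let e := shiftEquiv n 0 m (by omega)
  let s : Equiv.Perm {a : Fin n // 0 ≤ (a : ℕ) ∧ (a : ℕ) < 0 + m} :=
    u.subtypePerm fun a => by
      have := lt_iff_of_fixes hu a
      omega
  refine ⟨(e.trans s).trans e.symm, ?_⟩
  rw [shiftEmb, dif_pos (by omega)]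
  ext a
  by_cases ha : (a : ℕ) < m
  · rw [Equiv.Perm.extendDomain_apply_subtype _ _ (by omega)]
    simp [e, s]
  · rw [Equiv.Perm.extendDomain_apply_not_subtype _ _ (by omega), hu a (not_lt.mp ha)]

theorem pimg_eq {n : ℕ} (d : Equiv.Perm (Fin n)) {i : ℕ} (hi : i - 1 < n) :
    pimg d i = (d⁻¹ ⟨i - 1, hi⟩ : Fin n) + 1 := dif_pos hi

/-- Left multiplication of a minimal coset representative by the image of `w` does not
change the relative order of the images of points of the first block. -/
theorem pimg_shiftEmb_mul_lt_iff {n m : ℕ} (hm : m ≤ n) (w : Equiv.Perm (Fin m))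
    {v : Equiv.Perm (Fin n)} (hv : BlockMono m ⇑v⁻¹) {i j : ℕ} (hi : i - 1 < m)
    (hj : j - 1 < m) :
    pimg (shiftEmb n 0 m w * v) i < pimg (shiftEmb n 0 m w * v) j ↔ pimg w i < pimg w j := by
  have hb : ∀ a b : Fin m, v⁻¹ (Fin.castLE hm a) < v⁻¹ (Fin.castLE hm b) ↔ a < b := by
    have hmono : StrictMono fun a : Fin m => v⁻¹ (Fin.castLE hm a) :=
      fun a b hab => hv _ _ hab (by simp)
    exact fun a b => hmono.lt_iff_lt
  have himg : ∀ {k : ℕ} (hk : k - 1 < m), pimg (shiftEmb n 0 m w * v) k =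
      (v⁻¹ (Fin.castLE hm (w⁻¹ ⟨k - 1, hk⟩)) : Fin n) + 1 := by
    intro k hk
    rw [pimg_eq _ (hk.trans_le hm), ← shiftEmb_inv_castLE, mul_inv_rev]
    rfl
  rw [himg hi, himg hj, pimg_eq w hi, pimg_eq w hj, Nat.add_lt_add_iff_right,
    Nat.add_lt_add_iff_right, ← Fin.lt_def, ← Fin.lt_def, hb]

theorem shiftEmb_mul_mem_Hset_iff {n f : ℕ} (h : 2 * f ≤ n) (w : Equiv.Perm (Fin (2 * f)))
    {v : Equiv.Perm (Fin n)} (hv : BlockMono (2 * f) ⇑v⁻¹) :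
    shiftEmb n 0 (2 * f) w * v ∈ Hset n f ↔ w ∈ Hset (2 * f) f := by
  simp only [Hset, Finset.mem_filter, Finset.mem_univ, true_and]
  refine and_congr (forall₂_congr fun i hi => ?_)
    (and_congr (forall₂_congr fun i hi => ?_) ?_)
  · rw [Finset.mem_Icc] at hi
    exact pimg_shiftEmb_mul_lt_iff h w hv (by omega) (by omega)
  · rw [Finset.mem_Icc] at hi
    exact pimg_shiftEmb_mul_lt_iff h w hv (by omega) (by omega)
  · refine iff_of_true (fun j hj => ?_) fun j hj => ?_
    · rw [Finset.mem_Icc] at hj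
      rw [pimg_eq _ (by omega), pimg_eq _ (by omega), Nat.add_lt_add_iff_right, ← Fin.lt_def,
        mul_inv_rev, Equiv.Perm.mul_apply, Equiv.Perm.mul_apply,
        inv_fixes (shiftEmb_fixes h w) _ (by simp only; omega),
        inv_fixes (shiftEmb_fixes h w) _ (by simp only; omega)]
      exact hv _ _ (by simp only [Fin.mk_lt_mk]; omega) (by simp only; omega)
    · rw [Finset.mem_Icc] at hj
      omega

theorem exists_shiftEmb_mul_blockMono {n f : ℕ} (h : 2 * f ≤ n) {d : Equiv.Perm (Fin n)}
    (hd : d ∈ Hset n f) :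
    ∃ (w : Equiv.Perm (Fin (2 * f))) (v : Equiv.Perm (Fin n)),
      BlockMono (2 * f) ⇑v⁻¹ ∧ d = shiftEmb n 0 (2 * f) w * v := by
  classical
  simp only [Hset, Finset.mem_filter, Finset.mem_univ, true_and] at hd
  let S : Finset (Equiv.Perm (Fin n)) :=
    Finset.univ.filter fun x => ∀ a : Fin n, 2 * f ≤ (a : ℕ) → x a = a
  obtain ⟨x, hx, hmin⟩ := S.exists_min_image (fun x => len (x * d)) ⟨1, by simp [S]⟩
  have hfix : ∀ a : Fin n, 2 * f ≤ (a : ℕ) → x a = a := by simpa [S] using hx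
  obtain ⟨w, hw⟩ := exists_shiftEmb_eq h (inv_fixes hfix)
  refine ⟨w, x * d, blockMono_of_adjacent fun i hi him => ?_, by rw [hw]; group⟩
  by_cases hif : i < 2 * f
  · refine inv_lt_of_len_le_swap_mul rfl ?_
    rw [← mul_assoc]
    refine hmin _ ?_
    simp only [S, Finset.mem_filter, Finset.mem_univ, true_and]
    intro a ha
    rw [Equiv.Perm.mul_apply, hfix a ha]
    apply Equiv.swap_apply_of_ne_of_ne <;> rw [Ne, Fin.ext_iff] <;> simp only <;> omega
  · have h3 := hd.2.2 (i + 1) (Finset.mem_Icc.mpr (by omega))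
    rw [pimg_eq _ (by omega), pimg_eq _ (by omega), Nat.add_lt_add_iff_right, ← Fin.lt_def] at h3
    rw [mul_inv_rev, Equiv.Perm.mul_apply, Equiv.Perm.mul_apply,
      inv_fixes hfix _ (by simp only; omega), inv_fixes hfix _ (by simp only; omega)]
    exact h3

theorem eq_of_mul_eq_of_blockMono {n m : ℕ} {u u' v v' : Equiv.Perm (Fin n)}
    (hu : ∀ a, (u a : ℕ) < m ↔ (a : ℕ) < m) (hu' : ∀ a, (u' a : ℕ) < m ↔ (a : ℕ) < m)
    (hv : BlockMono m ⇑v⁻¹) (hv' : BlockMono m ⇑v'⁻¹) (he : u * v = u' * v') :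
    u = u' ∧ v = v' := by
  have hinv : ∀ {y : Equiv.Perm (Fin n)}, (∀ a, (y a : ℕ) < m ↔ (a : ℕ) < m) →
      ∀ a, ((y⁻¹ a : Fin n) : ℕ) < m ↔ (a : ℕ) < m := fun hy a => by rw [← hy]; simp
  have h1 : len (u⁻¹ * u' * v') = len (u⁻¹ * u') + len v' :=
    len_mul_of_blockMono (fun a => by rw [Equiv.Perm.mul_apply, hinv hu, hu']) hv'
  have h2 : len (u'⁻¹ * u * v) = len (u'⁻¹ * u) + len v :=
    len_mul_of_blockMono (fun a => by rw [Equiv.Perm.mul_apply, hinv hu', hu]) hv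
  rw [mul_assoc, ← he, inv_mul_cancel_left] at h1
  rw [mul_assoc, he, inv_mul_cancel_left] at h2
  have h3 : u⁻¹ * u' = 1 := eq_one_of_len_eq_zero (by omega)
  obtain rfl := inv_mul_eq_one.mp h3
  exact ⟨rfl, mul_left_cancel he⟩

/-- `H_f(n) = H_f^{{1,…,2f}} · D_{(2f,n-2f)}`: unique factorizations,
with lengths adding, and conversely all such products lie in `H_f(n)`. -/
theorem statement5 (n f : ℕ) (h : 2 * f ≤ n) :
    (∀ d ∈ Hset n f,
      (∃! uv : Equiv.Perm (Fin n) × Equiv.Perm (Fin n),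
        uv.1 ∈ (Hset (2 * f) f).image (shiftEmb n 0 (2 * f)) ∧
        uv.2 ∈ Dset n [2 * f, n - 2 * f] ∧ d = uv.1 * uv.2) ∧
      (∀ u v : Equiv.Perm (Fin n),
        u ∈ (Hset (2 * f) f).image (shiftEmb n 0 (2 * f)) →
        v ∈ Dset n [2 * f, n - 2 * f] → d = u * v → len d = len u + len v)) ∧
    (∀ u ∈ (Hset (2 * f) f).image (shiftEmb n 0 (2 * f)),
      ∀ v ∈ Dset n [2 * f, n - 2 * f], u * v ∈ Hset n f) := by
  have hyoung : ∀ w : Equiv.Perm (Fin (2 * f)), ∀ a,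
      (shiftEmb n 0 (2 * f) w a : ℕ) < 2 * f ↔ (a : ℕ) < 2 * f :=
    fun w => lt_iff_of_fixes (shiftEmb_fixes h w)
  refine ⟨fun d hd => ⟨?_, ?_⟩, ?_⟩
  · obtain ⟨w, v, hv, rfl⟩ := exists_shiftEmb_mul_blockMono h hd
    refine ⟨(shiftEmb n 0 (2 * f) w, v), ⟨Finset.mem_image_of_mem _
      ((shiftEmb_mul_mem_Hset_iff h w hv).mp hd), (mem_Dset_two_iff h).mpr hv, rfl⟩, ?_⟩
    rintro ⟨u', v'⟩ ⟨hu', hv', he⟩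
    obtain ⟨w', -, rfl⟩ := Finset.mem_image.mp hu'
    obtain ⟨h1, h2⟩ := eq_of_mul_eq_of_blockMono (hyoung w) (hyoung w') hv
      ((mem_Dset_two_iff h).mp hv') he
    exact Prod.ext h1.symm h2.symm
  · rintro u v hu hv rfl
    obtain ⟨w, -, rfl⟩ := Finset.mem_image.mp hu
    exact len_mul_of_blockMono (hyoung w) ((mem_Dset_two_iff h).mp hv)
  · intro u hu v hv
    obtain ⟨w, hw, rfl⟩ := Finset.mem_image.mp hu
    exact (shiftEmb_mul_mem_Hset_iff h w ((mem_Dset_two_iff h).mp hv)).mpr hw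

end BMWPaper
end
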